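/- The Clifford algebra C₈ is isomorphic as a real algebra to the algebra of 16 × 16 real matrices, ℝ(16). -/

import Mathlib

/-- The Clifford algebra `C_k` of the negative definite quadratic form
`Q(x) = -(x₁² + ⋯ + x_k²)` on `ℝ^k`. -/
abbrev CliffordC (k : ℕ) :=
  CliffordAlgebra (QuadraticMap.weightedSumSquares ℝ (fun _ : Fin k => (-1 : ℝ)))

open Matrix

/-- The nontrivial character `ZMod 2 → {1, -1}`, with real values. -/
def zmodTwoSign (t : ZMod 2) : ℝ := if t = 0 then 1 else -1

@[simp] lemma zmodTwoSign_zero : zmodTwoSign 0 = 1 := by simp [zmodTwoSign]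

@[simp] lemma zmodTwoSign_one : zmodTwoSign 1 = -1 := by simp [zmodTwoSign]

lemma zmodTwoSign_add (s t : ZMod 2) :
    zmodTwoSign (s + t) = zmodTwoSign s * zmodTwoSign t := by
  have key (t : ZMod 2) : t = 0 ∨ t = 1 := by revert t; decide
  rcases key s with rfl | rfl <;> rcases key t with rfl | rfl <;>
    simp [show (1 : ZMod 2) + 1 = 0 from rfl]

lemma zmodTwoSign_mul_self (t : ZMod 2) : zmodTwoSign t * zmodTwoSign t = 1 := by
  rw [← zmodTwoSign_add, CharTwo.add_self_eq_zero, zmodTwoSign_zero]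

lemma sum_zmodTwoSign_dotProduct {n : ℕ} (v : Fin n → ZMod 2) :
    ∑ b, zmodTwoSign (b ⬝ᵥ v) = if v = 0 then 2 ^ n else 0 := by
  split_ifs with h
  · simp [h]
  · obtain ⟨i, hi⟩ := Function.ne_iff.mp h
    have hi : v i = 1 := by
      have key (t : ZMod 2) : t ≠ 0 → t = 1 := by revert t; decide
      exact key _ hi
    have hs := Equiv.sum_comp (Equiv.addRight (Pi.single i 1 : Fin n → ZMod 2))
      fun b => zmodTwoSign (b ⬝ᵥ v)
    simp only [Equiv.coe_addRight, add_dotProduct, single_dotProduct, hi, mul_one,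
      zmodTwoSign_add, zmodTwoSign_one, mul_neg, Finset.sum_neg_distrib] at hs
    linarith

/-- The real Pauli (Weyl) matrix `Xᵃ Zᵇ` acting on functions on `(ZMod 2)ⁿ`: translation by `w.1`
after multiplication by the character attached to `w.2`. -/
def pauliMatrix {n : ℕ} (w : (Fin n → ZMod 2) × (Fin n → ZMod 2)) :
    Matrix (Fin n → ZMod 2) (Fin n → ZMod 2) ℝ :=
  of fun i j => if i = j + w.1 then zmodTwoSign (w.2 ⬝ᵥ j) else 0

section Pauli

variable {n : ℕ}

lemma pauliMatrix_zero : pauliMatrix (0 : (Fin n → ZMod 2) × (Fin n → ZMod 2)) = 1 := by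
  ext i j
  simp [pauliMatrix, one_apply]

lemma pauliMatrix_mul (w z : (Fin n → ZMod 2) × (Fin n → ZMod 2)) :
    pauliMatrix w * pauliMatrix z = zmodTwoSign (w.2 ⬝ᵥ z.1) • pauliMatrix (w + z) := by
  ext i k
  simp only [mul_apply, pauliMatrix, of_apply, Matrix.smul_apply, mul_ite, mul_zero,
    Finset.sum_ite_eq', Finset.mem_univ, if_true, smul_eq_mul, Prod.fst_add, Prod.snd_add,
    add_dotProduct, dotProduct_add, zmodTwoSign_add]
  rw [add_assoc, add_comm z.1]
  split_ifs <;> ring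

lemma single_eq_sum_pauliMatrix (u v : Fin n → ZMod 2) :
    Matrix.single u v (1 : ℝ) =
      ∑ b, ((2 ^ n)⁻¹ * zmodTwoSign (b ⬝ᵥ v)) • pauliMatrix (u - v, b) := by
  ext i j
  have hsum : ∑ b, zmodTwoSign (b ⬝ᵥ v) * zmodTwoSign (b ⬝ᵥ j) =
      if v = j then 2 ^ n else 0 := by
    have hvj : v + j = 0 ↔ v = j := by
      simp only [funext_iff, Pi.add_apply, Pi.zero_apply, CharTwo.add_eq_zero]
    simp only [← zmodTwoSign_add, ← dotProduct_add, sum_zmodTwoSign_dotProduct, hvj]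
  simp only [Matrix.sum_apply, Matrix.smul_apply, pauliMatrix, of_apply, smul_eq_mul, mul_ite, mul_zero,
    single_apply]
  by_cases h : i = j + (u - v)
  · simp only [h, if_true, mul_assoc, ← Finset.mul_sum, hsum]
    by_cases hv : v = j
    · subst hv
      simp
    · simp [hv]
  · simp only [h, if_false, Finset.sum_const_zero]
    rw [if_neg]
    rintro ⟨rfl, rfl⟩
    simp at h

lemma subalgebra_eq_top_of_pauliMatrix_mem
    (A : Subalgebra ℝ (Matrix (Fin n → ZMod 2) (Fin n → ZMod 2) ℝ))
    (hA : ∀ w, pauliMatrix w ∈ A) : A = ⊤ := by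
  refine eq_top_iff.mpr fun M _ => ?_
  rw [matrix_eq_sum_single M]
  refine sum_mem fun i _ => sum_mem fun j _ => ?_
  rw [← mul_one (M i j), ← smul_eq_mul, ← smul_single, single_eq_sum_pauliMatrix]
  exact A.smul_mem (sum_mem fun b _ => A.smul_mem (hA _) _) _

/-- The vectors labelling the Pauli matrices in a subalgebra. -/
def pauliLabels (A : Subalgebra ℝ (Matrix (Fin n → ZMod 2) (Fin n → ZMod 2) ℝ)) :
    AddSubmonoid ((Fin n → ZMod 2) × (Fin n → ZMod 2)) where
  carrier := {w | pauliMatrix w ∈ A}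
  zero_mem' := by
    simp only [Set.mem_ofPred_eq, pauliMatrix_zero]
    exact one_mem A
  add_mem' {w z} hw hz := by
    have h := A.smul_mem (A.mul_mem hw hz) (zmodTwoSign (w.2 ⬝ᵥ z.1))
    rwa [pauliMatrix_mul, smul_smul, zmodTwoSign_mul_self, one_smul] at h

lemma addSubmonoid_eq_top_of_single_mem
    (S : AddSubmonoid ((Fin n → ZMod 2) × (Fin n → ZMod 2)))
    (hl : ∀ i, (Pi.single i 1, 0) ∈ S) (hr : ∀ i, (0, Pi.single i 1) ∈ S) : S = ⊤ := by
  have key (t : ZMod 2) : t = 0 ∨ t = 1 := by revert t; decide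
  refine eq_top_iff.mpr fun w _ => ?_
  have hw : w = ∑ i, (Pi.single i (w.1 i), 0) + ∑ i, (0, Pi.single i (w.2 i)) := by
    ext j <;> simp [Prod.fst_sum, Prod.snd_sum, Finset.univ_sum_single]
  rw [hw]
  refine add_mem (sum_mem fun i _ => ?_) (sum_mem fun i _ => ?_)
  · rcases key (w.1 i) with h | h <;> rw [h]
    · rw [Pi.single_zero]; exact zero_mem S
    · exact hl i
  · rcases key (w.2 i) with h | h <;> rw [h]
    · rw [Pi.single_zero]; exact zero_mem S
    · exact hr i

end Pauli

lemma sum_smul_mul_self_of_anticommute {ι A : Type*} [Fintype ι] [DecidableEq ι] [Ring A]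
    [Algebra ℝ A] (e : ι → A)
    (he : ∀ i j, e i * e j + e j * e i = if i = j then -2 else 0) (x : ι → ℝ) :
    (∑ i, x i • e i) * (∑ i, x i • e i) = algebraMap ℝ A (-∑ i, x i * x i) := by
  have hexp : (∑ i, x i • e i) * (∑ i, x i • e i) = ∑ i, ∑ j, (x i * x j) • (e i * e j) := by
    simp only [Finset.sum_mul_sum, smul_mul_smul_comm]
  have hdouble : (2 : ℝ) • ((∑ i, x i • e i) * (∑ i, x i • e i)) =
      (2 : ℝ) • algebraMap ℝ A (-∑ i, x i * x i) := by
    calc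
      _ = ∑ i, ∑ j, (x i * x j) • (e i * e j + e j * e i) := by
        simp only [smul_add, Finset.sum_add_distrib]
        rw [two_smul, hexp]
        congr 1
        rw [Finset.sum_comm]
        exact Finset.sum_congr rfl fun i _ => Finset.sum_congr rfl fun j _ => by
          rw [mul_comm (x j)]
      _ = _ := by
        have h2 : (-2 : A) = algebraMap ℝ A (-2) := by rw [map_neg, map_ofNat]
        simp only [he, smul_ite, smul_zero, Finset.sum_ite_eq, Finset.mem_univ, if_true]
        simp only [h2, Algebra.smul_def, ← map_mul, ← map_sum]
        rw [← Finset.sum_mul]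
        congr 1
        ring
  exact smul_right_injective A (two_ne_zero (α := ℝ)) hdouble

/-- The algebra homomorphism from `C_k` given by `k` anticommuting square roots of `-1`. -/
noncomputable def CliffordC.lift {k : ℕ} {A : Type*} [Ring A] [Algebra ℝ A] (e : Fin k → A)
    (he : ∀ i j, e i * e j + e j * e i = if i = j then -2 else 0) : CliffordC k →ₐ[ℝ] A :=
  CliffordAlgebra.lift _ ⟨Fintype.linearCombination ℝ e, fun x => by
    simp only [Fintype.linearCombination_apply, sum_smul_mul_self_of_anticommute e he,
      QuadraticMap.weightedSumSquares_apply, smul_eq_mul, neg_one_mul, Finset.sum_neg_distrib]⟩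

lemma CliffordC.mem_range_lift {k : ℕ} {A : Type*} [Ring A] [Algebra ℝ A] (e : Fin k → A)
    (he : ∀ i j, e i * e j + e j * e i = if i = j then -2 else 0) (i : Fin k) :
    e i ∈ (CliffordC.lift e he).range :=
  ⟨CliffordAlgebra.ι _ (Pi.single i 1), by
    simp [CliffordC.lift, CliffordAlgebra.lift_ι_apply]⟩

/-- The standard basis of `C_k`, transported from the exterior algebra. -/
noncomputable def CliffordC.basis (k : ℕ) : Module.Basis (Finset (Fin k)) ℝ (CliffordC k) :=
  (Pi.basisFun ℝ (Fin k)).ExteriorAlgebra.map (CliffordAlgebra.equivExterior _).symm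

lemma CliffordC.finrank_eq (k : ℕ) : Module.finrank ℝ (CliffordC k) = 2 ^ k := by
  simp [Module.finrank_eq_card_basis (CliffordC.basis k)]

/-- Labels of eight pairwise anticommuting real Pauli matrices with square `-1`. -/
def cliffordEightLabel : Fin 8 → (Fin 4 → ZMod 2) × (Fin 4 → ZMod 2) :=
  ![(![1, 0, 0, 0], ![1, 0, 0, 0]), (![0, 1, 0, 0], ![1, 1, 0, 0]),
    (![1, 1, 0, 0], ![0, 1, 1, 0]), (![0, 0, 1, 0], ![1, 1, 1, 0]),
    (![1, 0, 1, 0], ![0, 0, 1, 0]), (![0, 1, 1, 0], ![1, 0, 1, 0]),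
    (![1, 1, 1, 0], ![0, 1, 0, 1]), (![1, 1, 1, 1], ![0, 1, 0, 0])]

lemma pauliMatrix_cliffordEightLabel_anticommute (i j : Fin 8) :
    pauliMatrix (cliffordEightLabel i) * pauliMatrix (cliffordEightLabel j) +
      pauliMatrix (cliffordEightLabel j) * pauliMatrix (cliffordEightLabel i) =
        if i = j then -2 else 0 := by
  have hdiag : ∀ i, (cliffordEightLabel i).2 ⬝ᵥ (cliffordEightLabel i).1 = 1 := by decide
  have hoff : ∀ i j, i ≠ j → (cliffordEightLabel i).2 ⬝ᵥ (cliffordEightLabel j).1 =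
      (cliffordEightLabel j).2 ⬝ᵥ (cliffordEightLabel i).1 + 1 := by decide
  have hself : ∀ i, cliffordEightLabel i + cliffordEightLabel i = 0 := by decide
  split_ifs with h
  · subst h
    rw [pauliMatrix_mul, hdiag, hself, pauliMatrix_zero, zmodTwoSign_one, neg_one_smul,
      ← neg_add, one_add_one_eq_two]
  · rw [pauliMatrix_mul, pauliMatrix_mul, hoff i j h, zmodTwoSign_add, zmodTwoSign_one,
      add_comm (cliffordEightLabel j), ← add_smul]
    simp

lemma addSubmonoid_eq_top_of_cliffordEightLabel_mem
    (S : AddSubmonoid ((Fin 4 → ZMod 2) × (Fin 4 → ZMod 2)))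
    (hS : ∀ i, cliffordEightLabel i ∈ S) : S = ⊤ := by
  have hl : ∀ i, (Pi.single i 1, 0) = ∑ j ∈ (![{0, 1, 3, 5}, {0, 4, 5}, {2, 3, 4, 5},
      {0, 1, 2, 3, 4, 5, 7}] : Fin 4 → Finset (Fin 8)) i, cliffordEightLabel j := by decide
  have hr : ∀ i, (0, Pi.single i 1) = ∑ j ∈ (![{1, 3, 5}, {0, 3, 4}, {0, 1, 2},
      {0, 1, 2, 3, 4, 5, 6}] : Fin 4 → Finset (Fin 8)) i, cliffordEightLabel j := by decide
  refine addSubmonoid_eq_top_of_single_mem S (fun i => ?_) (fun i => ?_)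
  · rw [hl]
    exact sum_mem fun j _ => hS j
  · rw [hr]
    exact sum_mem fun j _ => hS j

/-- `C₈ ≅ ℝ(16)`, the `16 × 16` real matrices, as real algebras. -/
theorem cliffordC_eight : Nonempty (CliffordC 8 ≃ₐ[ℝ] Matrix (Fin 16) (Fin 16) ℝ) := by
  let φ := CliffordC.lift _ pauliMatrix_cliffordEightLabel_anticommute
  have hrange : φ.range = ⊤ := by
    have hlabels := addSubmonoid_eq_top_of_cliffordEightLabel_mem (pauliLabels φ.range)
      fun i => CliffordC.mem_range_lift _ pauliMatrix_cliffordEightLabel_anticommute i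
    exact subalgebra_eq_top_of_pauliMatrix_mem _ fun w =>
      (hlabels ▸ AddSubmonoid.mem_top w : w ∈ pauliLabels φ.range)
  have hsurj : Function.Surjective φ := AlgHom.range_eq_top φ |>.mp hrange
  have hfin : Module.finrank ℝ (CliffordC 8) =
      Module.finrank ℝ (Matrix (Fin 4 → ZMod 2) (Fin 4 → ZMod 2) ℝ) := by
    simp [CliffordC.finrank_eq, Module.finrank_matrix]
  have : FiniteDimensional ℝ (CliffordC 8) := (CliffordC.basis 8).finiteDimensional_of_finite
  have hinj : Function.Injective φ :=
    (LinearMap.injective_iff_surjective_of_finrank_eq_finrank hfin (f := φ.toLinearMap)).mpr hsurj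
  exact ⟨(AlgEquiv.ofBijective φ ⟨hinj, hsurj⟩).trans
    (reindexAlgEquiv ℝ ℝ (Fintype.equivFinOfCardEq (by simp)))⟩
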